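/- No wandering intervals for induced maps. Let 𝒩⁰, 𝒥 and T : 𝒥 → [0,1] satisfy conditions (1)–(3). For n ≥ 1 let e_n denote the supremum of |I| over all connected components I of ⋂_{k=0}^{n−1} T^{−k}(𝒥). Then e_n → 0 as n → ∞. -/

import Mathlib

open MeasureTheory Set Filter

noncomputable section

/-- The setting of Mañé's theorem for induced maps: a family `𝒩⁰` of pairwise disjoint
compact subintervals of `(0,1)` with nonempty interior, and a map `T : 𝒥 → [0,1]`
(`𝒥 = ⋃ 𝒩⁰`) such that: (1) `T` restricted to each `J ∈ 𝒩⁰` is a `C¹` diffeomorphism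
onto `[0,1]`; (2) `T` has `D_d`-bounded distortion on each `J ∈ 𝒩⁰`; (3) every periodic
orbit of `T` (of minimal period `q`) is hyperbolic repelling. -/
structure InducedSetup where
  /-- the family `𝒩⁰` of intervals -/
  Nfam : Set (Set ℝ)
  /-- the induced map, given as a global map whose relevant values are those on `𝒥` -/
  T : ℝ → ℝ
  /-- the distortion constant `D_d` -/
  Dd : ℝ
  hN : ∀ J ∈ Nfam, IsCompact J ∧ J.OrdConnected ∧ (interior J).Nonempty ∧ J ⊆ Set.Ioo 0 1
  hdisj : Nfam.Pairwise Disjoint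
  hdiffeo : ∀ J ∈ Nfam, Set.BijOn T J (Set.Icc 0 1) ∧
    (∀ x ∈ J, DifferentiableAt ℝ T x ∧ deriv T x ≠ 0) ∧ ContinuousOn (deriv T) J
  hDd : 0 < Dd
  hdist : ∀ J ∈ Nfam, ∀ x ∈ J, ∀ y ∈ J, deriv T x / deriv T y ≤ 1 + Dd * |T x - T y|
  hper : ∀ (x : ℝ) (q : ℕ), 1 ≤ q → (∀ k < q, T^[k] x ∈ ⋃₀ Nfam) → T^[q] x = x →
    (∀ k, 0 < k → k < q → T^[k] x ≠ x) →
    1 < |∏ k ∈ Finset.range q, deriv T (T^[k] x)|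

/-- The domain `𝒥 = ⋃_{J ∈ 𝒩⁰} J` of the induced map. -/
def InducedSetup.J (S : InducedSetup) : Set ℝ := ⋃₀ S.Nfam

/-- The derivative `DT^n` of the `n`-th iterate of `T`, written via the chain rule as
the product of the derivatives of `T` along the orbit. -/
noncomputable def derIter (T : ℝ → ℝ) (n : ℕ) (x : ℝ) : ℝ :=
  ∏ k ∈ Finset.range n, deriv T (T^[k] x)

/-- The set `⋂_{k=0}^{n-1} T^{-k}(𝒥)` of points whose first `n` iterates stay in `𝒥`. -/
def InducedSetup.inter (S : InducedSetup) (n : ℕ) : Set ℝ :=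
  ⋂ k ∈ Finset.range n, S.T^[k] ⁻¹' S.J

/-- `e_n`: the supremum of the lengths of the connected components of
`⋂_{k=0}^{n-1} T^{-k}(𝒥)`. -/
noncomputable def InducedSetup.eN (S : InducedSetup) (n : ℕ) : ℝ :=
  sSup ((fun x => (volume (connectedComponentIn (S.inter n) x)).toReal) '' S.inter n)

namespace InducedSetup

variable (S : InducedSetup)

/-- The cylinder of order `n` around `x`: the points of `[0,1]` whose first `n` iterates visit
the same branches as those of `x`. -/
def cyl (n : ℕ) (x : ℝ) : Set ℝ :=
  {y ∈ Icc 0 1 | ∀ k < n, ∃ J ∈ S.Nfam, S.T^[k] x ∈ J ∧ S.T^[k] y ∈ J}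

/-- The points of `[0,1]` with the same itinerary as `x`. -/
def limCyl (x : ℝ) : Set ℝ :=
  {y ∈ Icc 0 1 | ∀ k, ∃ J ∈ S.Nfam, S.T^[k] x ∈ J ∧ S.T^[k] y ∈ J}

variable {S}

lemma mem_inter {n : ℕ} {x : ℝ} : x ∈ S.inter n ↔ ∀ k < n, S.T^[k] x ∈ S.J := by
  simp [InducedSetup.inter]

lemma eq_of_mem {J K : Set ℝ} {x : ℝ} (hJ : J ∈ S.Nfam) (hK : K ∈ S.Nfam) (hxJ : x ∈ J)
    (hxK : x ∈ K) : J = K := by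
  by_contra h
  exact Set.disjoint_left.1 (S.hdisj hJ hK h) hxJ hxK

lemma eq_Icc {J : Set ℝ} (hJ : J ∈ S.Nfam) : ∃ l r, l < r ∧ J = Icc l r := by
  obtain ⟨hc, ho, hi, -⟩ := S.hN J hJ
  have hne : J.Nonempty := hi.mono interior_subset
  have heq := eq_Icc_of_connected_compact ⟨hne, ho.isPreconnected⟩ hc
  refine ⟨sInf J, sSup J, ?_, heq⟩
  rw [heq, interior_Icc] at hi
  obtain ⟨y, hy⟩ := hi
  exact hy.1.trans hy.2

lemma subset_unit {J : Set ℝ} (hJ : J ∈ S.Nfam) : J ⊆ Icc 0 1 :=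
  (S.hN J hJ).2.2.2.trans Ioo_subset_Icc_self

lemma continuousOn_T {J : Set ℝ} (hJ : J ∈ S.Nfam) : ContinuousOn S.T J := fun x hx =>
  ((S.hdiffeo J hJ).2.1 x hx).1.continuousAt.continuousWithinAt

lemma strictMonoOn_or_strictAntiOn {J : Set ℝ} (hJ : J ∈ S.Nfam) :
    StrictMonoOn S.T J ∨ StrictAntiOn S.T J := by
  have hc := continuousOn_T hJ
  have hi := (S.hdiffeo J hJ).1.injOn
  obtain ⟨l, r, hlr, rfl⟩ := eq_Icc hJ
  exact hc.strictMonoOn_of_injOn_Icc' hlr.le hi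

lemma endpoint_values {l r : ℝ} (hlr : l < r) (hJ : Icc l r ∈ S.Nfam) :
    (S.T l = 0 ∨ S.T l = 1) ∧ (S.T r = 0 ∨ S.T r = 1) := by
  have hb := (S.hdiffeo _ hJ).1
  have hl : l ∈ Icc l r := left_mem_Icc.2 hlr.le
  have hr : r ∈ Icc l r := right_mem_Icc.2 hlr.le
  obtain ⟨u, hu, hu0⟩ := hb.surjOn (show (0 : ℝ) ∈ Icc 0 1 by simp)
  obtain ⟨v, hv, hv1⟩ := hb.surjOn (show (1 : ℝ) ∈ Icc 0 1 by simp)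
  have h1 := hb.mapsTo hl
  have h2 := hb.mapsTo hr
  rcases strictMonoOn_or_strictAntiOn hJ with h | h
  · have h3 := h.monotoneOn hl hu hu.1
    have h4 := h.monotoneOn hv hr hv.2
    exact ⟨Or.inl (by linarith [h1.1]), Or.inr (by linarith [h2.2])⟩
  · have h3 := h.antitoneOn hu hr hu.2
    have h4 := h.antitoneOn hl hv hv.1
    exact ⟨Or.inr (by linarith [h1.2]), Or.inl (by linarith [h2.1])⟩

lemma T_mem_unit {x : ℝ} (hx : x ∈ S.J) : S.T x ∈ Icc (0 : ℝ) 1 := by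
  obtain ⟨J, hJ, hxJ⟩ := hx
  exact (S.hdiffeo J hJ).1.mapsTo hxJ

/-- An endpoint of a branch is not interior to `𝒥`. -/
lemma not_mem_nhds {J : Set ℝ} {x : ℝ} (hJ : J ∈ S.Nfam) (hx : x ∈ J)
    (hT : S.T x = 0 ∨ S.T x = 1) : S.J ∉ nhds x := by
  intro h
  apply ((S.hdiffeo J hJ).2.1 x hx).2
  rcases hT with hT | hT
  · apply IsLocalMin.deriv_eq_zero
    filter_upwards [h] with y hy
    exact hT ▸ (T_mem_unit hy).1
  · apply IsLocalMax.deriv_eq_zero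
    filter_upwards [h] with y hy
    exact hT ▸ (T_mem_unit hy).2

/-- A preconnected subset of `𝒥` lies in a single branch. -/
lemma subset_branch {C J : Set ℝ} {x : ℝ} (hC : IsPreconnected C) (hCJ : C ⊆ S.J)
    (hJ : J ∈ S.Nfam) (hxC : x ∈ C) (hxJ : x ∈ J) : C ⊆ J := by
  obtain ⟨l, r, hlr, rfl⟩ := eq_Icc hJ
  have ho := hC.ordConnected
  have hJJ : Icc l r ⊆ S.J := subset_sUnion_of_mem hJ
  obtain ⟨hl, hr⟩ := endpoint_values hlr hJ
  intro y hy
  by_contra hyJ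
  rw [mem_Icc, not_and_or, not_le, not_le] at hyJ
  rcases hyJ with h | h
  · refine not_mem_nhds hJ (left_mem_Icc.2 hlr.le) hl ?_
    filter_upwards [Ioo_mem_nhds h hlr] with z hz
    rcases le_total z l with h' | h'
    · exact hCJ (ho.out hy hxC ⟨hz.1.le, h'.trans hxJ.1⟩)
    · exact hJJ ⟨h', hz.2.le⟩
  · refine not_mem_nhds hJ (right_mem_Icc.2 hlr.le) hr ?_
    filter_upwards [Ioo_mem_nhds hlr h] with z hz
    rcases le_total z r with h' | h'
    · exact hJJ ⟨hz.1.le, h'⟩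
    · exact hCJ (ho.out hxC hy ⟨hxJ.2.trans h', hz.2.le⟩)

lemma iterate_mem_inter {n k : ℕ} {x : ℝ} (hx : x ∈ S.inter (k + n)) :
    S.T^[k] x ∈ S.inter n := by
  rw [mem_inter] at hx ⊢
  intro i hi
  rw [← Function.iterate_add_apply]
  exact hx _ (by omega)

lemma subset_cyl (n : ℕ) {C : Set ℝ} {x : ℝ} (hC : IsPreconnected C) (hCn : C ⊆ S.inter n)
    (hC1 : C ⊆ Icc 0 1) (hx : x ∈ C) : C ⊆ S.cyl n x := by
  induction n generalizing C x with
  | zero => exact fun y hy => ⟨hC1 hy, by simp⟩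
  | succ n ih =>
    have hCJ : C ⊆ S.J := fun y hy => mem_inter.1 (hCn hy) 0 (by omega)
    obtain ⟨J, hJ, hxJ⟩ := hCJ hx
    have hsub := subset_branch hC hCJ hJ hx hxJ
    have key := ih (hC.image _ ((continuousOn_T hJ).mono hsub))
      (by
        rintro _ ⟨y, hy, rfl⟩
        exact iterate_mem_inter (k := 1) (by rw [add_comm]; exact hCn hy))
      (by
        rintro _ ⟨y, hy, rfl⟩
        exact T_mem_unit (hCJ hy)) (mem_image_of_mem S.T hx)
    intro y hy
    refine ⟨hC1 hy, fun k hk => ?_⟩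
    cases k with
    | zero => exact ⟨J, hJ, hxJ, hsub hy⟩
    | succ k => exact (key (mem_image_of_mem S.T hy)).2 k (by omega)

lemma cyl_succ {n : ℕ} {J : Set ℝ} {x : ℝ} (hJ : J ∈ S.Nfam) (hx : x ∈ J) :
    S.cyl (n + 1) x = J ∩ S.T ⁻¹' S.cyl n (S.T x) := by
  ext y
  constructor
  · rintro ⟨-, hy⟩
    obtain ⟨K, hK, hxK, hyK⟩ := hy 0 (by omega)
    rw [eq_of_mem hK hJ hxK hx] at hyK
    exact ⟨hyK, T_mem_unit ⟨J, hJ, hyK⟩, fun k hk => hy (k + 1) (by omega)⟩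
  · rintro ⟨hyJ, -, hy⟩
    refine ⟨subset_unit hJ hyJ, fun k hk => ?_⟩
    cases k with
    | zero => exact ⟨J, hJ, hx, hyJ⟩
    | succ k => exact hy k (by omega)

lemma cyl_structure (n : ℕ) {x : ℝ} (hx : x ∈ S.inter n) :
    IsCompact (S.cyl n x) ∧ (S.cyl n x).OrdConnected ∧
      BijOn S.T^[n] (S.cyl n x) (Icc 0 1) := by
  induction n generalizing x with
  | zero =>
    have : S.cyl 0 x = Icc 0 1 := by ext; simp [cyl]
    rw [this]
    exact ⟨isCompact_Icc, ordConnected_Icc, bijOn_id _⟩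
  | succ n ih =>
    obtain ⟨J, hJ, hxJ : x ∈ J⟩ := mem_inter.1 hx 0 (by omega)
    obtain ⟨h1, h2, h3⟩ := ih (iterate_mem_inter (k := 1) (by rwa [add_comm] at hx))
    simp only [Function.iterate_one] at h1 h2 h3
    rw [cyl_succ hJ hxJ]
    have hb := (S.hdiffeo J hJ).1
    have hJo := (S.hN J hJ).2.1
    refine ⟨?_, ?_, ?_⟩
    · exact (S.hN J hJ).1.of_isClosed_subset
        ((continuousOn_T hJ).preimage_isClosed_of_isClosed (S.hN J hJ).1.isClosed h1.isClosed)
        inter_subset_left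
    · constructor
      rintro u ⟨hu, hu'⟩ v ⟨hv, hv'⟩ z hz
      have hzJ := hJo.out hu hv hz
      refine ⟨hzJ, ?_⟩
      rcases strictMonoOn_or_strictAntiOn hJ with h | h
      · exact h2.out hu' hv' ⟨h.monotoneOn hu hzJ hz.1, h.monotoneOn hzJ hv hz.2⟩
      · exact h2.out hv' hu' ⟨h.antitoneOn hzJ hv hz.2, h.antitoneOn hu hzJ hz.1⟩
    · rw [Function.iterate_succ]
      refine h3.comp ⟨fun y hy => hy.2, hb.injOn.mono inter_subset_left, fun y hy => ?_⟩
      obtain ⟨z, hz, rfl⟩ := hb.surjOn hy.1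
      exact ⟨z, ⟨hz, hy⟩, rfl⟩

lemma limCyl_subset_cyl (n : ℕ) (x : ℝ) : S.limCyl x ⊆ S.cyl n x := fun _ hy =>
  ⟨hy.1, fun k _ => hy.2 k⟩

lemma limCyl_eq (x : ℝ) : S.limCyl x = ⋂ n, S.cyl n x := by
  ext y
  simp only [mem_iInter]
  exact ⟨fun h n => limCyl_subset_cyl n x h,
    fun h => ⟨(h 0).1, fun k => (h (k + 1)).2 k (by omega)⟩⟩

lemma limCyl_isCompact {x : ℝ} (hx : ∀ n, x ∈ S.inter n) : IsCompact (S.limCyl x) := by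
  rw [limCyl_eq]
  exact (cyl_structure 0 (hx 0)).1.of_isClosed_subset
    (isClosed_iInter fun n => (cyl_structure n (hx n)).1.isClosed) (iInter_subset _ 0)

lemma limCyl_ordConnected {x : ℝ} (hx : ∀ n, x ∈ S.inter n) : (S.limCyl x).OrdConnected := by
  rw [limCyl_eq]
  exact ordConnected_iInter fun n => (cyl_structure n (hx n)).2.1

lemma orbit_mem_inter {x : ℝ} (hx : ∀ n, x ∈ S.inter n) (k n : ℕ) : S.T^[k] x ∈ S.inter n :=
  iterate_mem_inter (hx (k + n))

lemma limCyl_orbit {x y : ℝ} (hy : y ∈ S.limCyl x) (n : ℕ) : y ∈ S.inter n := by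
  rw [mem_inter]
  intro k _
  obtain ⟨J, hJ, -, h⟩ := hy.2 k
  exact ⟨J, hJ, h⟩

lemma limCyl_eq_of_mem {x y : ℝ} (hy : y ∈ S.limCyl x) :
    S.limCyl y = S.limCyl x := by
  ext z
  refine and_congr_right fun _ => forall_congr' fun k => ?_
  obtain ⟨J, hJ, hxJ, hyJ⟩ := hy.2 k
  constructor
  · rintro ⟨K, hK, hyK, hzK⟩
    exact ⟨J, hJ, hxJ, eq_of_mem hK hJ hyK hyJ ▸ hzK⟩
  · rintro ⟨K, hK, hxK, hzK⟩
    exact ⟨J, hJ, hyJ, eq_of_mem hK hJ hxK hxJ ▸ hzK⟩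

lemma limCyl_bijOn {x : ℝ} (hx : ∀ n, x ∈ S.inter n) (q : ℕ) :
    BijOn S.T^[q] (S.limCyl x) (S.limCyl (S.T^[q] x)) := by
  have hb := (cyl_structure q (hx q)).2.2
  refine ⟨fun y hy => ⟨hb.mapsTo (limCyl_subset_cyl q x hy), fun k => ?_⟩,
    hb.injOn.mono (limCyl_subset_cyl q x), fun y hy => ?_⟩
  · simp only [← Function.iterate_add_apply]
    exact hy.2 _
  · obtain ⟨z, hz, rfl⟩ := hb.surjOn hy.1
    refine ⟨z, ⟨hz.1, fun k => ?_⟩, rfl⟩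
    rcases lt_or_ge k q with h | h
    · exact hz.2 k h
    · obtain ⟨i, rfl⟩ := Nat.exists_eq_add_of_le' h
      have := hy.2 i
      simp only [← Function.iterate_add_apply] at this
      exact this

lemma hasDerivAt_iterate (n : ℕ) {x : ℝ} (hx : x ∈ S.inter n) :
    HasDerivAt S.T^[n] (derIter S.T n x) x := by
  induction n with
  | zero => simpa [derIter] using hasDerivAt_id x
  | succ n ih =>
    have h := ih (mem_inter.2 fun k hk => mem_inter.1 hx k (by omega))
    obtain ⟨J, hJ, hxJ⟩ := mem_inter.1 hx n (by omega)
    have h' := ((S.hdiffeo J hJ).2.1 _ hxJ).1.hasDerivAt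
    rw [Function.iterate_succ', derIter, Finset.prod_range_succ, mul_comm]
    exact h'.comp x h

lemma cyl_subset_inter (n : ℕ) (x : ℝ) : S.cyl n x ⊆ S.inter n := fun y hy =>
  mem_inter.2 fun k hk => by
    obtain ⟨J, hJ, -, h⟩ := hy.2 k hk
    exact ⟨J, hJ, h⟩

/-- Bounded distortion of a single branch, with absolute values. -/
lemma abs_deriv_le {J : Set ℝ} {x y : ℝ} (hJ : J ∈ S.Nfam) (hx : x ∈ J) (hy : y ∈ J) :
    |deriv S.T x| ≤ Real.exp (S.Dd * |S.T x - S.T y|) * |deriv S.T y| := by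
  obtain ⟨-, hd, hc⟩ := S.hdiffeo J hJ
  have hpre := (S.hN J hJ).2.1.isPreconnected
  have hpos : 0 < deriv S.T x / deriv S.T y := by
    by_contra hcon
    have hx0 := (hd x hx).2
    have hy0 := (hd y hy).2
    have : (0 : ℝ) ∈ deriv S.T '' J := by
      rcases lt_or_gt_of_ne hx0 with h1 | h1 <;> rcases lt_or_gt_of_ne hy0 with h2 | h2
      · exact absurd (div_pos_of_neg_of_neg h1 h2) hcon
      · exact hpre.intermediate_value hx hy hc ⟨h1.le, h2.le⟩
      · exact hpre.intermediate_value hy hx hc ⟨h2.le, h1.le⟩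
      · exact absurd (div_pos h1 h2) hcon
    obtain ⟨z, hz, hz0⟩ := this
    exact (hd z hz).2 hz0
  rw [← div_le_iff₀ (abs_pos.2 (hd y hy).2), ← abs_div, abs_of_pos hpos]
  refine (S.hdist J hJ x hx y hy).trans ?_
  rw [add_comm]
  exact Real.add_one_le_exp _

/-- Distortion of an iterate on a cylinder. -/
lemma abs_derIter_le {n k : ℕ} (hk : k ≤ n) {x u v : ℝ} (hu : u ∈ S.cyl n x)
    (hv : v ∈ S.cyl n x) :
    |derIter S.T k u| ≤
      Real.exp (S.Dd * ∑ j ∈ Finset.range k, |S.T^[j + 1] u - S.T^[j + 1] v|) *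
        |derIter S.T k v| := by
  simp only [derIter, Finset.abs_prod, Finset.mul_sum, Real.exp_sum, ← Finset.prod_mul_distrib]
  refine Finset.prod_le_prod (fun _ _ => abs_nonneg _) fun j hj => ?_
  have hj' := (Finset.mem_range.1 hj).trans_le hk
  obtain ⟨J, hJ, hxJ, huJ⟩ := hu.2 j hj'
  obtain ⟨K, hK, hxK, hvK⟩ := hv.2 j hj'
  rw [eq_of_mem hK hJ hxK hxJ] at hvK
  simp only [Function.iterate_succ_apply']
  exact abs_deriv_le hJ huJ hvK

/-- Mean value theorem for an iterate on a cylinder. -/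
lemma exists_abs_derIter {n k : ℕ} (hk : k ≤ n) {x u v : ℝ} (hx : x ∈ S.inter n)
    (hu : u ∈ S.cyl n x) (hv : v ∈ S.cyl n x) :
    ∃ z ∈ S.cyl n x, |S.T^[k] u - S.T^[k] v| = |derIter S.T k z| * |u - v| := by
  wlog huv : u ≤ v generalizing u v
  · obtain ⟨z, hz, h⟩ := this hv hu (le_of_not_ge huv)
    exact ⟨z, hz, by rw [abs_sub_comm, h, abs_sub_comm]⟩
  rcases huv.eq_or_lt with rfl | huv
  · exact ⟨u, hu, by simp⟩
  have hsub : Icc u v ⊆ S.cyl n x := (cyl_structure n hx).2.1.out hu hv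
  have hd : ∀ z ∈ Icc u v, HasDerivAt S.T^[k] (derIter S.T k z) z := fun z hz =>
    hasDerivAt_iterate k (mem_inter.2 fun i hi =>
      mem_inter.1 (cyl_subset_inter n x (hsub hz)) i (hi.trans_le hk))
  obtain ⟨z, hz, h⟩ := exists_hasDerivAt_eq_slope S.T^[k] (derIter S.T k) huv
    (fun z hz => (hd z hz).continuousAt.continuousWithinAt)
    (fun z hz => hd z (Ioo_subset_Icc_self hz))
  refine ⟨z, hsub (Ioo_subset_Icc_self hz), ?_⟩
  rw [h, abs_sub_comm u v, abs_sub_comm (S.T^[k] u), ← abs_mul,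
    div_mul_cancel₀ _ (sub_pos.2 huv).ne']

lemma derIter_mul {T : ℝ → ℝ} {q : ℕ} {x : ℝ} (hq : T^[q] x = x) (m : ℕ) :
    derIter T (q * m) x = derIter T q x ^ m := by
  induction m with
  | zero => simp [derIter]
  | succ m ih =>
    have hm : T^[q * m] x = x := (Function.IsPeriodicPt.mul_const (n := m) hq)
    rw [pow_succ, ← ih, Nat.mul_succ, derIter, Finset.prod_range_add]
    congr 1
    refine Finset.prod_congr rfl fun k _ => ?_
    rw [add_comm, Function.iterate_add_apply, hm]

/-- The multiplier of a periodic point exceeds one in absolute value for any of its periods. -/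
lemma one_lt_abs_derIter {p : ℕ} {x : ℝ} (hp : 1 ≤ p) (hx : ∀ n, x ∈ S.inter n)
    (hfix : S.T^[p] x = x) : 1 < |derIter S.T p x| := by
  have hper : Function.IsPeriodicPt S.T p x := hfix
  obtain ⟨m, hm⟩ := hper.minimalPeriod_dvd
  have hq : S.T^[Function.minimalPeriod S.T x] x = x := Function.iterate_minimalPeriod
  have h1 : 1 < |derIter S.T (Function.minimalPeriod S.T x) x| :=
    S.hper x _ (hper.minimalPeriod_pos hp) (fun k _ => mem_inter.1 (hx (k + 1)) k (by omega)) hq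
      fun k hk hkq h => Function.not_isPeriodicPt_of_pos_of_lt_minimalPeriod hk.ne' hkq h
  rw [hm, derIter_mul hq, abs_pow]
  exact one_lt_pow₀ h1 (by rintro rfl; omega)

end InducedSetup

/-- A map of `[a, b]` fixing both endpoints cannot have all its fixed points repelling with
positive multiplier. -/
lemma exists_fixedPoint_deriv_le_one {g g' : ℝ → ℝ} {a b : ℝ} (hab : a < b)
    (hg : ∀ x ∈ Icc a b, HasDerivAt g (g' x) x) (ha : g a = a) (hb : g b = b) :
    ∃ x ∈ Icc a b, g x = x ∧ g' x ≤ 1 := by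
  by_contra! hcon
  have hle : ∀ ⦃x⦄, x ∈ Icc a b → x ≤ g x :=
    image_le_of_deriv_right_lt_deriv_boundary' (f := id) (f' := fun _ => 1) (B' := g')
      continuousOn_id (fun x _ => (hasDerivAt_id x).hasDerivWithinAt) ha.ge
      (fun x hx => (hg x hx).continuousAt.continuousWithinAt)
      (fun x hx => (hg x (Ico_subset_Icc_self hx)).hasDerivWithinAt)
      (fun x hx h => hcon x (Ico_subset_Icc_self hx) h.symm)
  have hbm : b ∈ Icc a b := right_mem_Icc.2 hab.le
  have hs := (hasDerivWithinAt_iff_tendsto_slope' self_notMem_Iio).1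
    (hg b hbm).hasDerivWithinAt
  have : g' b ≤ 1 := by
    refine le_of_tendsto hs ?_
    filter_upwards [Ioo_mem_nhdsLT hab] with x hx
    rw [slope_def_field, hb, div_le_one_of_neg (by linarith [hx.2])]
    linarith [hle ⟨hx.1.le, hx.2.le⟩]
  exact (hcon b hbm hb).not_ge this

lemma StrictMonoOn.fixes_endpoints {g : ℝ → ℝ} {a b : ℝ} (hab : a ≤ b)
    (hg : StrictMonoOn g (Icc a b)) (hb : BijOn g (Icc a b) (Icc a b)) : g a = a ∧ g b = b := by
  have ha' := left_mem_Icc.2 hab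
  have hb' := right_mem_Icc.2 hab
  obtain ⟨u, hu, hua⟩ := hb.surjOn ha'
  obtain ⟨v, hv, hvb⟩ := hb.surjOn hb'
  have h1 := hg.monotoneOn ha' hu hu.1
  have h2 := hg.monotoneOn hv hb' hv.2
  exact ⟨le_antisymm (by linarith) (hb.mapsTo ha').1, le_antisymm (hb.mapsTo hb').2 (by linarith)⟩

namespace InducedSetup

variable {S : InducedSetup}

lemma limCyl_eq_Icc {x : ℝ} (hx : ∀ n, x ∈ S.inter n) (hx1 : x ∈ Icc (0 : ℝ) 1) :
    ∃ a b, S.limCyl x = Icc a b := by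
  have hmem : x ∈ S.limCyl x := ⟨hx1, fun k => by
    obtain ⟨J, hJ, h⟩ := mem_inter.1 (hx (k + 1)) k (by omega)
    exact ⟨J, hJ, h, h⟩⟩
  exact ⟨_, _, eq_Icc_of_connected_compact ⟨⟨x, hmem⟩, (limCyl_ordConnected hx).isPreconnected⟩
    (limCyl_isCompact hx)⟩

/-- A nondegenerate limit cylinder is not periodic. -/
lemma limCyl_not_periodic {x a b : ℝ} {q : ℕ} (hx : ∀ n, x ∈ S.inter n) (hq : 1 ≤ q)
    (hab : a < b) (hW : S.limCyl x = Icc a b) : S.limCyl (S.T^[q] x) ≠ S.limCyl x := by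
  intro heq
  have hbij := limCyl_bijOn hx q
  rw [heq, hW] at hbij
  have horb : ∀ z ∈ Icc a b, ∀ n, z ∈ S.inter n := fun z hz n => limCyl_orbit (hW ▸ hz) n
  have hc : ContinuousOn S.T^[q] (Icc a b) := fun z hz =>
    (hasDerivAt_iterate q (horb z hz q)).continuousAt.continuousWithinAt
  have hmono : StrictMonoOn S.T^[q + q] (Icc a b) := by
    rw [Function.iterate_add]
    rcases hc.strictMonoOn_of_injOn_Icc' hab.le hbij.injOn with h | h
    · exact h.comp h hbij.mapsTo
    · exact h.comp h hbij.mapsTo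
  have hbij2 : BijOn S.T^[q + q] (Icc a b) (Icc a b) := by
    rw [Function.iterate_add]
    exact hbij.comp hbij
  obtain ⟨ha, hb⟩ := hmono.fixes_endpoints hab.le hbij2
  have hd : ∀ z ∈ Icc a b, HasDerivAt S.T^[q + q] (derIter S.T (q + q) z) z := fun z hz =>
    hasDerivAt_iterate _ (horb z hz _)
  obtain ⟨z, hz, hfix, hle⟩ := exists_fixedPoint_deriv_le_one hab hd ha hb
  have h1 := one_lt_abs_derIter (p := q + q) (by omega) (horb z hz) hfix
  have h0 : 0 ≤ derIter S.T (q + q) z := by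
    rw [← (hd z hz).hasDerivWithinAt.derivWithin (uniqueDiffOn_Icc hab z hz)]
    exact hmono.monotoneOn.derivWithin_nonneg
  rw [abs_of_nonneg h0] at h1
  linarith

/-- Lengths of the limit cylinders along an orbit. -/
lemma abs_iterate_sub_le {x u v : ℝ} (hx : ∀ n, x ∈ S.inter n) (hu : u ∈ S.limCyl x)
    (hv : v ∈ S.limCyl x) (k : ℕ) :
    |S.T^[k] u - S.T^[k] v| ≤ volume.real (S.limCyl (S.T^[k] x)) := by
  have hk := orbit_mem_inter hx k
  have hb := limCyl_bijOn hx k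
  have hsub := (limCyl_ordConnected hk).uIcc_subset (hb.mapsTo hv) (hb.mapsTo hu)
  have hfin := (limCyl_isCompact hk).measure_lt_top (μ := volume)
  have := measureReal_mono hsub hfin.ne
  rwa [Real.volume_real_interval] at this

/-- A nondegenerate limit cylinder cannot have an orbit of very small total length. -/
lemma limCyl_not_wandering {x a b : ℝ} (hx : ∀ n, x ∈ S.inter n) (hab : a < b)
    (hW : S.limCyl x = Icc a b)
    (hs : Summable fun k => volume.real (S.limCyl (S.T^[k] x))) :
    1 < 2 * Real.exp (2 * S.Dd) * ∑' k, volume.real (S.limCyl (S.T^[k] x)) := by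
  by_contra! hsmall
  set C := 2 * Real.exp (2 * S.Dd) with hC
  set v := fun k => volume.real (S.limCyl (S.T^[k] x))
  have hC0 : 0 < C := by positivity
  have hv0 : ∀ k, 0 ≤ v k := fun k => measureReal_nonneg
  have hDd := S.hDd
  have haW : a ∈ S.limCyl x := hW ▸ left_mem_Icc.2 hab.le
  have hbW : b ∈ S.limCyl x := hW ▸ right_mem_Icc.2 hab.le
  have hout : ∀ p, p ∉ Icc a b → ∃ N, ∀ n ≥ N, p ∉ S.cyl n x := by
    intro p hp
    rw [← hW, limCyl_eq, mem_iInter, not_forall] at hp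
    obtain ⟨N, hN⟩ := hp
    exact ⟨N, fun n hn h => hN ⟨h.1, fun k hk => h.2 k (hk.trans_le hn)⟩⟩
  obtain ⟨N₁, hN₁⟩ := hout (a - (b - a) / 2) (fun h => by linarith [h.1])
  obtain ⟨N₂, hN₂⟩ := hout (b + (b - a) / 2) (fun h => by linarith [h.2])
  obtain ⟨n, hn₁, hn₂, hvn⟩ : ∃ n, N₁ ≤ n ∧ N₂ ≤ n ∧ v n < 1 / C :=
    ((eventually_ge_atTop N₁).and ((eventually_ge_atTop N₂).and
      (hs.tendsto_atTop_zero.eventually_lt_const (by positivity)))).exists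
  have ho := (cyl_structure n (hx n)).2.1
  have hac := limCyl_subset_cyl n x haW
  have hbc := limCyl_subset_cyl n x hbW
  have hbd : ∀ u ∈ S.cyl n x, a - (b - a) / 2 < u ∧ u < b + (b - a) / 2 := by
    intro u hu
    constructor
    · by_contra! h
      exact hN₁ n hn₁ (ho.out hu hac ⟨h, by linarith⟩)
    · by_contra! h
      exact hN₂ n hn₂ (ho.out hbc hu ⟨by linarith, h⟩)
  have hunit : ∀ k ≤ n, ∀ u ∈ S.cyl n x, S.T^[k] u ∈ Icc (0 : ℝ) 1 := by
    intro k hk u hu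
    exact (cyl_structure k (hx k)).2.2.mapsTo ⟨hu.1, fun i hi => hu.2 i (hi.trans_le hk)⟩
  have main : ∀ k ≤ n, ∀ u ∈ S.cyl n x, ∀ w ∈ S.cyl n x, |S.T^[k] u - S.T^[k] w| ≤ C * v k := by
    intro k
    induction k using Nat.strong_induction_on with
    | _ k ih =>
    intro hk u hu w hw
    obtain ⟨z, hz, hzeq⟩ := exists_abs_derIter hk (hx n) hu hw
    obtain ⟨y, hy, hyeq⟩ := exists_abs_derIter hk (hx n) hbc hac
    have hdist := abs_derIter_le hk hz hy
    have hsum : ∑ j ∈ Finset.range k, |S.T^[j + 1] z - S.T^[j + 1] y| ≤ 2 := by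
      calc ∑ j ∈ Finset.range k, |S.T^[j + 1] z - S.T^[j + 1] y|
          ≤ ∑ j ∈ Finset.range (k + 1), |S.T^[j] z - S.T^[j] y| := by
            rw [Finset.sum_range_succ']
            exact le_add_of_nonneg_right (abs_nonneg _)
        _ ≤ ∑ j ∈ Finset.range k, C * v j + 1 := by
            rw [Finset.sum_range_succ]
            refine add_le_add (Finset.sum_le_sum fun j hj => ?_) ?_
            · have hj := Finset.mem_range.1 hj
              exact ih j hj (hj.le.trans hk) z hz y hy
            · have h1 := hunit k hk z hz
              have h2 := hunit k hk y hy
              exact abs_le.2 ⟨by linarith [h1.1, h2.2], by linarith [h1.2, h2.1]⟩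
        _ ≤ 2 := by
            rw [← Finset.mul_sum]
            have := mul_le_mul_of_nonneg_left
              (hs.sum_le_tsum (Finset.range k) fun j _ => hv0 j) hC0.le
            linarith
    have hexp : Real.exp (S.Dd * ∑ j ∈ Finset.range k, |S.T^[j + 1] z - S.T^[j + 1] y|) ≤
        Real.exp (2 * S.Dd) := Real.exp_le_exp.2 (by nlinarith)
    have huw : |u - w| ≤ 2 * |b - a| := by
      rw [abs_of_pos (sub_pos.2 hab)]
      have h1 := hbd u hu
      have h2 := hbd w hw
      exact abs_le.2 ⟨by linarith, by linarith⟩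
    have hlen : |S.T^[k] b - S.T^[k] a| ≤ v k := abs_iterate_sub_le hx hbW haW k
    calc |S.T^[k] u - S.T^[k] w| = |derIter S.T k z| * |u - w| := hzeq
      _ ≤ (Real.exp (2 * S.Dd) * |derIter S.T k y|) * (2 * |b - a|) := by
          gcongr
          exact hdist.trans (by gcongr)
      _ = C * |S.T^[k] b - S.T^[k] a| := by rw [hyeq, hC]; ring
      _ ≤ C * v k := by gcongr
  have hsurj := (cyl_structure n (hx n)).2.2.surjOn
  obtain ⟨u, hu, hu0⟩ := hsurj (show (0 : ℝ) ∈ Icc 0 1 by simp)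
  obtain ⟨w, hw, hw1⟩ := hsurj (show (1 : ℝ) ∈ Icc 0 1 by simp)
  have := main n le_rfl w hw u hu
  rw [hu0, hw1] at this
  rw [lt_div_iff₀ hC0] at hvn
  norm_num at this
  linarith

/-- There are no wandering intervals: points with the same itinerary coincide. -/
lemma limCyl_subsingleton {x : ℝ} (hx : ∀ n, x ∈ S.inter n) : (S.limCyl x).Subsingleton := by
  by_contra hsub
  rw [Set.not_subsingleton_iff] at hsub
  have hnt : ∀ k, ∃ a b, a < b ∧ S.limCyl (S.T^[k] x) = Icc a b := by
    intro k
    have hk := orbit_mem_inter hx k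
    have hne := (limCyl_bijOn hx k).image_eq ▸ hsub.image_of_injOn (limCyl_bijOn hx k).injOn
    obtain ⟨J, hJ, hxJ⟩ := mem_inter.1 (hk 1) 0 (by omega)
    obtain ⟨a, b, hab⟩ := limCyl_eq_Icc hk (subset_unit hJ hxJ)
    refine ⟨a, b, ?_, hab⟩
    rw [hab] at hne
    by_contra! h
    exact Set.not_subsingleton_iff.2 hne (subsingleton_Icc_of_ge h)
  have hdisj' : ∀ i j, i < j → Disjoint (S.limCyl (S.T^[i] x)) (S.limCyl (S.T^[j] x)) := by
    intro i j hij
    rw [Set.disjoint_left]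
    intro z hzi hzj
    obtain ⟨q, rfl⟩ := Nat.exists_eq_add_of_lt hij
    obtain ⟨a, b, hab, hW⟩ := hnt i
    refine limCyl_not_periodic (q := q + 1) (orbit_mem_inter hx i) (by omega) hab hW ?_
    rw [← Function.iterate_add_apply, add_comm, ← add_assoc, ← limCyl_eq_of_mem hzi,
      limCyl_eq_of_mem hzj]
  have hdisj : Pairwise (Function.onFun Disjoint fun k => S.limCyl (S.T^[k] x)) := by
    intro i j hij
    rcases lt_or_gt_of_ne hij with h | h
    · exact hdisj' i j h
    · exact (hdisj' j i h).symm
  have hs : Summable fun k => volume.real (S.limCyl (S.T^[k] x)) := by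
    refine ENNReal.summable_toReal ?_
    rw [← measure_iUnion hdisj fun k =>
      (limCyl_isCompact (orbit_mem_inter hx k)).measurableSet]
    refine ((measure_mono (iUnion_subset fun k y hy => hy.1)).trans_lt
      (isCompact_Icc (a := (0 : ℝ)) (b := 1)).measure_lt_top).ne
  have hlim := (tendsto_sum_nat_add fun k => volume.real (S.limCyl (S.T^[k] x))).const_mul
    (2 * Real.exp (2 * S.Dd))
  rw [mul_zero] at hlim
  obtain ⟨m, hm⟩ := (hlim.eventually_lt_const one_pos).exists
  obtain ⟨a, b, hab, hW⟩ := hnt m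
  have := limCyl_not_wandering (orbit_mem_inter hx m) hab hW
  simp only [← Function.iterate_add_apply] at this
  exact (this ((summable_nat_add_iff m).2 hs)).not_gt hm

/-- The lengths of the cylinders of order `n` tend to zero uniformly. -/
lemma cyl_length_eventually_le {ε : ℝ} (hε : 0 < ε) :
    ∃ N, ∀ n ≥ N, ∀ x ∈ S.inter n, volume (S.cyl n x) ≤ ENNReal.ofReal ε := by
  by_contra! hcon
  have key : ∀ N, ∃ m ∈ Icc (0 : ℝ) 1, Icc (m - ε / 2) (m + ε / 2) ⊆ S.inter N ∩ Icc 0 1 := by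
    intro N
    obtain ⟨n, hn, x, hx, hvol⟩ := hcon N
    obtain ⟨hc, ho, -⟩ := cyl_structure n hx
    have hne : (S.cyl n x).Nonempty := by
      by_contra h
      rw [Set.not_nonempty_iff_eq_empty] at h
      simp [h] at hvol
    have hI := eq_Icc_of_connected_compact ⟨hne, ho.isPreconnected⟩ hc
    generalize sInf (S.cyl n x) = a at hI
    generalize sSup (S.cyl n x) = b at hI
    rw [hI, Real.volume_Icc, ENNReal.ofReal_lt_ofReal_iff_of_nonneg hε.le] at hvol
    have hsub : Icc a b ⊆ S.inter N ∩ Icc 0 1 := by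
      rw [← hI]
      intro y hy
      exact ⟨mem_inter.2 fun k hk =>
        mem_inter.1 (cyl_subset_inter n x hy) k (hk.trans_le hn), hy.1⟩
    refine ⟨(a + b) / 2, (hsub ⟨by linarith, by linarith⟩).2, ?_⟩
    exact (Icc_subset_Icc (by linarith) (by linarith)).trans hsub
  choose m hm hmsub using key
  obtain ⟨c, -, φ, hφ, hlim⟩ := isCompact_Icc.tendsto_subseq hm
  have hU : ∀ n, Icc (c - ε / 4) (c + ε / 4) ⊆ S.inter n ∩ Icc 0 1 := by
    intro n y hy
    obtain ⟨i, hi, hdist⟩ := ((eventually_ge_atTop n).and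
      (hlim.eventually (Metric.ball_mem_nhds c (show 0 < ε / 4 by positivity)))).exists
    rw [Function.comp_apply, Real.dist_eq, abs_lt] at hdist
    have hy' := hmsub (φ i) (⟨by linarith [hy.1], by linarith [hy.2]⟩ :
      y ∈ Icc (m (φ i) - ε / 2) (m (φ i) + ε / 2))
    have hni : n ≤ φ i := hi.trans (hφ.id_le i)
    exact ⟨mem_inter.2 fun k hk => mem_inter.1 hy'.1 k (hk.trans_le hni), hy'.2⟩
  have hl : c - ε / 4 ∈ Icc (c - ε / 4) (c + ε / 4) := ⟨le_rfl, by linarith⟩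
  have hr : c + ε / 4 ∈ Icc (c - ε / 4) (c + ε / 4) := ⟨by linarith, le_rfl⟩
  have hWsub : Icc (c - ε / 4) (c + ε / 4) ⊆ S.limCyl (c - ε / 4) := by
    rw [limCyl_eq]
    exact subset_iInter fun n => subset_cyl n isPreconnected_Icc (fun y hy => (hU n hy).1)
      (fun y hy => (hU n hy).2) hl
  have := limCyl_subsingleton (fun n => (hU n hl).1) (hWsub hl) (hWsub hr)
  linarith

end InducedSetup

/-- **No wandering intervals for induced maps.** Under conditions (1)–(3), the supremum
`e_n` of the lengths of the connected components of `⋂_{k=0}^{n−1} T^{−k}(𝒥)` tends to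
`0` as `n → ∞`. -/
theorem no_wandering_intervals (S : InducedSetup) :
    Tendsto S.eN atTop (nhds 0) := by
  rw [Metric.tendsto_atTop]
  intro ε hε
  obtain ⟨N, hN⟩ := S.cyl_length_eventually_le (half_pos hε)
  refine ⟨N + 1, fun n hn => ?_⟩
  have h0 : 0 ≤ S.eN n := Real.sSup_nonneg (by
    rintro _ ⟨x, -, rfl⟩
    exact ENNReal.toReal_nonneg)
  have hle : S.eN n ≤ ε / 2 := by
    refine Real.sSup_le ?_ (half_pos hε).le
    rintro _ ⟨x, hx, rfl⟩
    refine ENNReal.toReal_le_of_le_ofReal (half_pos hε).le (le_trans (measure_mono ?_)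
      (hN n (by omega) x hx))
    refine InducedSetup.subset_cyl n isPreconnected_connectedComponentIn
      (connectedComponentIn_subset _ _) (fun y hy => ?_) (mem_connectedComponentIn hx)
    obtain ⟨J, hJ, hyJ⟩ :=
      InducedSetup.mem_inter.1 (connectedComponentIn_subset _ _ hy) 0 (by omega)
    exact InducedSetup.subset_unit hJ hyJ
  rw [Real.dist_0_eq_abs, abs_of_nonneg h0]
  linarith
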